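/- Let x₁ ∈ (−2, 0) be the unique zero of F in (−2, 0). Then for every natural number k ≥ 1 and every real x ∈ (k, k+2+x₁] ∪ [k+2, ∞) one has F(x−k−1)/Γ(x−k) ≤ 1, with equality if and only if x = k+2+x₁ or x = k+2. -/

import Mathlib

open MeasureTheory

/-- The real part of the alternating Kurepa function:
`F(x) = ∫₀^∞ e^{−t} (t^{x+1} − cos(πx)·t)/(t+1) dt`, convergent for `x > −2`. -/
noncomputable def reAltKurepa (x : ℝ) : ℝ :=
  ∫ t in Set.Ioi (0 : ℝ), Real.exp (-t) * (t ^ (x + 1) - Real.cos (Real.pi * x) * t) / (t + 1)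

/-- The Mellin-type transform `∫₀^∞ e^{-t} t^{x+1}/(t+1) dt`. -/
noncomputable def kurepaMellin (x : ℝ) : ℝ :=
  ∫ t in Set.Ioi (0 : ℝ), Real.exp (-t) * t ^ (x + 1) / (t + 1)

lemma integrableOn_exp_neg_mul_rpow {x : ℝ} (hx : -2 < x) :
    IntegrableOn (fun t : ℝ => Real.exp (-t) * t ^ (x + 1)) (Set.Ioi 0) := by
  have h := Real.GammaIntegral_convergent (s := x + 2) (by linarith)
  rwa [show x + 2 - 1 = x + 1 by ring] at h

lemma integrableOn_kurepaMellin {x : ℝ} (hx : -2 < x) :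
    IntegrableOn (fun t : ℝ => Real.exp (-t) * t ^ (x + 1) / (t + 1)) (Set.Ioi 0) := by
  refine (integrableOn_exp_neg_mul_rpow hx).mono' ?_ ?_
  · exact Measurable.aestronglyMeasurable (by fun_prop)
  · refine (ae_restrict_iff' measurableSet_Ioi).2 (Filter.Eventually.of_forall fun t ht => ?_)
    have ht : 0 < t := ht
    rw [Real.norm_of_nonneg (by positivity)]
    exact div_le_self (by positivity) (by linarith)

lemma reAltKurepa_eq {x : ℝ} (hx : -2 < x) :
    reAltKurepa x = kurepaMellin x - Real.cos (Real.pi * x) * kurepaMellin 0 := by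
  unfold reAltKurepa kurepaMellin
  rw [← integral_const_mul, ← integral_sub (integrableOn_kurepaMellin hx)
    ((integrableOn_kurepaMellin (by norm_num : (-2 : ℝ) < 0)).const_mul _)]
  congr 1
  ext t
  rw [zero_add, Real.rpow_one]
  ring

lemma kurepaMellin_add_sub_one {y : ℝ} (hy : -1 < y) :
    kurepaMellin y + kurepaMellin (y - 1) = Real.Gamma (y + 1) := by
  unfold kurepaMellin
  rw [← integral_add (integrableOn_kurepaMellin (by linarith))
    (integrableOn_kurepaMellin (by linarith)), Real.Gamma_eq_integral (by linarith)]
  refine setIntegral_congr_fun measurableSet_Ioi fun t ht => ?_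
  have ht : 0 < t := ht
  simp only [sub_add_cancel, add_sub_cancel_right]
  rw [Real.rpow_add_one ht.ne']
  field_simp

lemma reAltKurepa_add_sub_one {y : ℝ} (hy : -1 < y) :
    reAltKurepa y + reAltKurepa (y - 1) = Real.Gamma (y + 1) := by
  rw [reAltKurepa_eq (by linarith), reAltKurepa_eq (by linarith), ← kurepaMellin_add_sub_one hy,
    mul_sub, mul_one, Real.cos_sub_pi]
  ring

lemma reAltKurepa_zero : reAltKurepa 0 = 0 := by
  rw [reAltKurepa_eq (by norm_num)]
  simp

lemma continuousOn_kurepaMellin : ContinuousOn kurepaMellin (Set.Ioi (-2)) := by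
  intro x hx
  have hx : -2 < x := hx
  refine ContinuousAt.continuousWithinAt ?_
  obtain ⟨a, ha, hax⟩ := exists_between hx
  refine continuousAt_of_dominated
    (bound := fun t => Real.exp (-t) * t ^ (a + 1) + Real.exp (-t) * t ^ (x + 1 + 1)) ?_ ?_
    ((integrableOn_exp_neg_mul_rpow ha).add
      (integrableOn_exp_neg_mul_rpow (by linarith : -2 < x + 1))) ?_
  · exact Filter.Eventually.of_forall fun z => Measurable.aestronglyMeasurable (by fun_prop)
  · filter_upwards [Ioo_mem_nhds hax (lt_add_one x)] with z hz
    refine (ae_restrict_iff' measurableSet_Ioi).2 (Filter.Eventually.of_forall fun t ht => ?_)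
    have ht : 0 < t := ht
    rw [Real.norm_of_nonneg (by positivity), ← mul_add]
    refine (div_le_self (by positivity) (by linarith)).trans ?_
    gcongr
    rcases le_total t 1 with h | h
    · have h1 := Real.rpow_le_rpow_of_exponent_ge ht h (by linarith [hz.1] : a + 1 ≤ z + 1)
      have : 0 ≤ t ^ (x + 1 + 1) := by positivity
      linarith
    · have h1 := Real.rpow_le_rpow_of_exponent_le h (by linarith [hz.2] : z + 1 ≤ x + 1 + 1)
      have : 0 ≤ t ^ (a + 1) := by positivity
      linarith
  · refine (ae_restrict_iff' measurableSet_Ioi).2 (Filter.Eventually.of_forall fun t ht => ?_)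
    have ht : 0 < t := ht
    have : ContinuousAt (fun z : ℝ => t ^ (z + 1)) x :=
      (Real.continuousAt_const_rpow ht.ne').comp (by fun_prop)
    exact (continuousAt_const.mul this).div_const _

lemma continuousOn_reAltKurepa : ContinuousOn reAltKurepa (Set.Ioi (-2)) := by
  have h : ContinuousOn
      (fun x => kurepaMellin x - Real.cos (Real.pi * x) * kurepaMellin 0) (Set.Ioi (-2)) :=
    continuousOn_kurepaMellin.sub (by fun_prop)
  exact h.congr fun x hx => reAltKurepa_eq hx

lemma kurepaMellin_zero_nonneg : 0 ≤ kurepaMellin 0 := by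
  refine setIntegral_nonneg measurableSet_Ioi fun t ht => ?_
  have ht : 0 < t := ht
  positivity

/-- `reAltKurepa` tends to `+∞` at `-2` from the right. -/
lemma tendsto_reAltKurepa_nhdsGT_neg_two :
    Filter.Tendsto reAltKurepa (nhdsWithin (-2) (Set.Ioi (-2))) Filter.atTop := by
  have hΓ : Filter.Tendsto (fun z : ℝ => Real.Gamma (z + 1 + 1))
      (nhdsWithin (-2) (Set.Ioi (-2))) Filter.atTop := by
    have h1 : Filter.Tendsto (fun z : ℝ => z + 2)
        (nhdsWithin (-2) (Set.Ioi (-2))) (nhdsWithin 0 (Set.Ioi 0)) := by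
      refine tendsto_nhdsWithin_iff.2 ⟨?_, ?_⟩
      · have : ContinuousAt (fun z : ℝ => z + 2) (-2) := by fun_prop
        have h2 := this.tendsto
        norm_num at h2
        exact h2.mono_left nhdsWithin_le_nhds
      · filter_upwards [self_mem_nhdsWithin] with z hz
        have hz : -2 < z := hz
        exact (by linarith : 0 < z + 2)
    have h3 : Filter.Tendsto (fun z : ℝ => Real.Gamma (z + 1) * z⁻¹)
        (nhdsWithin 0 (Set.Ioi 0)) Filter.atTop := by
      have : ContinuousAt (fun z : ℝ => Real.Gamma (z + 1)) 0 := by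
        have hd : ContinuousAt Real.Gamma (0 + 1) :=
          (Real.differentiableAt_Gamma fun m => by
            have : (0 : ℝ) ≤ m := Nat.cast_nonneg m
            linarith).continuousAt
        exact ContinuousAt.comp (f := fun z : ℝ => z + 1) hd (by fun_prop)
      have h4 := this.tendsto
      rw [zero_add, Real.Gamma_one] at h4
      exact (h4.mono_left nhdsWithin_le_nhds).pos_mul_atTop one_pos tendsto_inv_nhdsGT_zero
    refine (h3.comp h1).congr' ?_
    filter_upwards [self_mem_nhdsWithin] with z hz
    have hz : -2 < z := hz
    have hz' : z + 2 ≠ 0 := by linarith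
    simp only [Function.comp]
    rw [Real.Gamma_add_one hz', show z + 1 + 1 = z + 2 by ring]
    field_simp
  have hF : Filter.Tendsto (fun z : ℝ => -reAltKurepa (z + 1))
      (nhdsWithin (-2) (Set.Ioi (-2))) (nhds (-reAltKurepa (-2 + 1))) := by
    have h : ContinuousAt reAltKurepa (-2 + 1) :=
      continuousOn_reAltKurepa.continuousAt (Ioi_mem_nhds (by norm_num))
    have h' : ContinuousAt (fun z : ℝ => reAltKurepa (z + 1)) (-2) :=
      ContinuousAt.comp (f := fun z : ℝ => z + 1) h (by fun_prop)
    exact (h'.tendsto.mono_left nhdsWithin_le_nhds).neg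
  refine (hΓ.atTop_add hF).congr' ?_
  filter_upwards [self_mem_nhdsWithin] with z hz
  have hz : -2 < z := hz
  have h := reAltKurepa_add_sub_one (by linarith : -1 < z + 1)
  rw [add_sub_cancel_right] at h
  linarith

/-- `reAltKurepa` is positive to the left of its first zero. -/
lemma reAltKurepa_pos_of_forall_ne_zero {z : ℝ} (hz : -2 < z)
    (h : ∀ y, -2 < y → y ≤ z → reAltKurepa y ≠ 0) : 0 < reAltKurepa z := by
  by_contra! hle
  obtain ⟨w, ⟨hw, hw2⟩, hwz⟩ :=
    ((tendsto_reAltKurepa_nhdsGT_neg_two.eventually_gt_atTop 0).and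
      (self_mem_nhdsWithin)).and (Ioo_mem_nhdsGT hz) |>.exists
  have hcont : ContinuousOn reAltKurepa (Set.Icc w z) :=
    continuousOn_reAltKurepa.mono fun y hy => lt_of_lt_of_le hw2 hy.1
  obtain ⟨c, hc, hc0⟩ := intermediate_value_Icc' hwz.2.le hcont ⟨hle, hw.le⟩
  exact h c (lt_of_lt_of_le hw2 hc.1) hc.2 hc0

lemma rational_le_mul_log {t : ℝ} (ht : 1 ≤ t) :
    (t + 1) * ((t - 1) / 2 - (t - 1) ^ 2 / 16) / t ≤ Real.log t := by
  have hmono : MonotoneOn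
      (fun s : ℝ => Real.log s - (s + 1) * ((s - 1) / 2 - (s - 1) ^ 2 / 16) / s) (Set.Ici 1) := by
    refine monotoneOn_of_hasDerivWithinAt_nonneg (convex_Ici 1) (f' := fun s =>
      (s - 1) * (2 * (s - 1) ^ 2 - 3 * (s - 1) + 4) / (16 * s ^ 2)) ?_ ?_ ?_
    · intro s hs
      have hs : (s : ℝ) ≠ 0 := by
        have : 1 ≤ s := hs
        positivity
      exact ContinuousAt.continuousWithinAt (by fun_prop (disch := assumption))
    · intro s hs
      rw [interior_Ici] at hs
      have hs : 1 < s := hs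
      have hs0 : s ≠ 0 := by positivity
      have h1 : HasDerivAt (fun s : ℝ => s - 1) 1 s := (hasDerivAt_id s).sub_const 1
      have h2 : HasDerivAt (fun s : ℝ => s + 1) 1 s := (hasDerivAt_id s).add_const 1
      have h3 := (Real.hasDerivAt_log hs0).sub
        ((h2.mul ((h1.div_const 2).sub ((h1.pow 2).div_const 16))).div (hasDerivAt_id s) hs0)
      refine (h3.congr_deriv ?_).hasDerivWithinAt
      simp
      field_simp
      ring
    · intro s hs
      rw [interior_Ici] at hs
      have hs : 1 < s := hs
      have : 0 < 2 * (s - 1) ^ 2 - 3 * (s - 1) + 4 := by nlinarith [sq_nonneg (4 * (s - 1) - 3)]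
      have : 0 < s - 1 := by linarith
      positivity
  have h := hmono Set.self_mem_Ici ht ht
  norm_num at h
  linarith

lemma integral_Ioi_one_exp_neg_mul :
    IntegrableOn (fun t : ℝ => Real.exp (-t) * ((t - 1) / 2 - (t - 1) ^ 2 / 16)) (Set.Ioi 1) ∧
    ∫ t in Set.Ioi (1 : ℝ), Real.exp (-t) * ((t - 1) / 2 - (t - 1) ^ 2 / 16)
      = 3 / 8 * Real.exp (-1) := by
  have hint : IntegrableOn (fun t : ℝ => Real.exp (-t) * ((t - 1) / 2 - (t - 1) ^ 2 / 16))
      (Set.Ioi 1) := by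
    have h0 := integrableOn_exp_neg_mul_rpow (by norm_num : (-2 : ℝ) < -1)
    have h1 := integrableOn_exp_neg_mul_rpow (by norm_num : (-2 : ℝ) < 0)
    have h2 := integrableOn_exp_neg_mul_rpow (by norm_num : (-2 : ℝ) < 1)
    have h : IntegrableOn (fun t : ℝ => -1 / 16 * (Real.exp (-t) * t ^ ((1 : ℝ) + 1))
        + (5 / 8 * (Real.exp (-t) * t ^ ((0 : ℝ) + 1))
        + -9 / 16 * (Real.exp (-t) * t ^ ((-1 : ℝ) + 1)))) (Set.Ioi 0) :=
      (h2.const_mul _).add ((h1.const_mul _).add (h0.const_mul _))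
    refine (h.mono_set (Set.Ioi_subset_Ioi zero_le_one)).congr_fun (fun t ht => ?_) measurableSet_Ioi
    norm_num
    ring
  refine ⟨hint, ?_⟩
  have hd : ∀ t : ℝ, HasDerivAt
      (fun t : ℝ => -(Real.exp (-t) * (3 / 8 + 3 / 8 * (t - 1) - (t - 1) ^ 2 / 16)))
      (Real.exp (-t) * ((t - 1) / 2 - (t - 1) ^ 2 / 16)) t := fun t => by
    have h1 : HasDerivAt (fun s : ℝ => s - 1) 1 t := (hasDerivAt_id t).sub_const 1
    refine (((hasDerivAt_neg t).exp.mul (((h1.const_mul (3 / 8)).const_add (3 / 8)).sub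
      ((h1.pow 2).div_const 16))).neg).congr_deriv ?_
    simp
    ring
  have hlim : Filter.Tendsto
      (fun t : ℝ => -(Real.exp (-t) * (3 / 8 + 3 / 8 * (t - 1) - (t - 1) ^ 2 / 16)))
      Filter.atTop (nhds 0) := by
    have h0 := Real.tendsto_pow_mul_exp_neg_atTop_nhds_zero 0
    have h1 := Real.tendsto_pow_mul_exp_neg_atTop_nhds_zero 1
    have h2 := Real.tendsto_pow_mul_exp_neg_atTop_nhds_zero 2
    have h := (h2.const_mul (1 / 16)).add ((h1.const_mul (-1 / 2)).add (h0.const_mul (1 / 16)))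
    simp only [mul_zero, add_zero] at h
    refine h.congr fun t => ?_
    ring
  rw [integral_Ioi_of_hasDerivAt_of_tendsto' (fun t _ => hd t) hint hlim]
  norm_num
  ring

lemma exp_neg_div_add_one_le {t : ℝ} (h0 : 0 ≤ t) :
    Real.exp (-t) / (t + 1) ≤ 1 - 3 / 2 * t + 3 / 4 * t ^ 2 := by
  have he : 1 + t + t ^ 2 / 2 ≤ Real.exp t := Real.quadratic_le_exp_of_nonneg h0
  have hq : 0 ≤ 1 - 3 / 2 * t + 3 / 4 * t ^ 2 := by nlinarith [sq_nonneg (t - 1)]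
  rw [Real.exp_neg, div_le_iff₀ (by linarith), inv_le_iff_one_le_mul₀ (Real.exp_pos t)]
  calc (1 : ℝ) ≤ (1 - 3 / 2 * t + 3 / 4 * t ^ 2) * (t + 1) * (1 + t + t ^ 2 / 2) := by
        have : 0 ≤ 4 - 6 * t - 2 * t ^ 2 + 3 * t ^ 3 + 3 * t ^ 4 := by
          nlinarith [sq_nonneg (t ^ 2 - 9 / 16), sq_nonneg (t - 3 / 4),
            mul_nonneg h0 (sq_nonneg (t - 3 / 4))]
        nlinarith [mul_nonneg h0 this]
    _ ≤ _ := by gcongr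

lemma kurepaMellin_zero_lt {y : ℝ} (hy : 0 < y) : kurepaMellin 0 < kurepaMellin y := by
  have hI0 := integrableOn_kurepaMellin (by norm_num : (-2 : ℝ) < 0)
  have hIy := integrableOn_kurepaMellin (by linarith : -2 < y)
  have hI : IntegrableOn (fun t : ℝ => Real.exp (-t) * t ^ (y + 1) / (t + 1)
      - Real.exp (-t) * t ^ ((0 : ℝ) + 1) / (t + 1)) (Set.Ioi 0) := hIy.sub hI0
  have hsub : kurepaMellin y - kurepaMellin 0 = ∫ t in Set.Ioi (0 : ℝ),
      (Real.exp (-t) * t ^ (y + 1) / (t + 1) - Real.exp (-t) * t ^ ((0 : ℝ) + 1) / (t + 1)) :=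
    (integral_sub hIy hI0).symm
  rw [← Set.Ioc_union_Ioi_eq_Ioi (zero_le_one (α := ℝ)),
    setIntegral_union (Set.Ioc_disjoint_Ioi le_rfl) measurableSet_Ioi
      (hI.mono_set Set.Ioc_subset_Ioi_self)
      (hI.mono_set (Set.Ioi_subset_Ioi zero_le_one))] at hsub
  have hA : y * (3 / 8 * Real.exp (-1)) ≤ ∫ t in Set.Ioi (1 : ℝ),
      (Real.exp (-t) * t ^ (y + 1) / (t + 1) - Real.exp (-t) * t ^ ((0 : ℝ) + 1) / (t + 1)) := by
    obtain ⟨hi, he⟩ := integral_Ioi_one_exp_neg_mul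
    rw [← he, ← integral_const_mul]
    refine setIntegral_mono_on (hi.const_mul y) (hI.mono_set (Set.Ioi_subset_Ioi zero_le_one))
      measurableSet_Ioi fun t ht => ?_
    have ht : 1 < t := ht
    have ht0 : 0 < t := by linarith
    have hl := rational_le_mul_log ht.le
    have hp : y * Real.log t + 1 ≤ t ^ y := by
      rw [Real.rpow_def_of_pos ht0, mul_comm y]
      exact Real.add_one_le_exp _
    rw [zero_add, Real.rpow_one, Real.rpow_add_one ht0.ne', ← sub_div, le_div_iff₀ (by linarith)]
    rw [div_le_iff₀ ht0] at hl
    have h1 := mul_le_mul_of_nonneg_left hl hy.le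
    have h2 := mul_le_mul_of_nonneg_right hp ht0.le
    have h3 : y * ((t + 1) * ((t - 1) / 2 - (t - 1) ^ 2 / 16)) ≤ t ^ y * t - t := by linarith
    have h4 := mul_le_mul_of_nonneg_left h3 (Real.exp_pos (-t)).le
    linarith
  have hB : -y * (25 / 192) ≤ ∫ t in Set.Ioc (0 : ℝ) 1,
      (Real.exp (-t) * t ^ (y + 1) / (t + 1) - Real.exp (-t) * t ^ ((0 : ℝ) + 1) / (t + 1)) := by
    have hr : ∀ {a : ℝ}, 0 ≤ a → IntervalIntegrable (fun t : ℝ => t ^ a) volume 0 1 :=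
      fun ha => intervalIntegral.intervalIntegrable_rpow' (by linarith)
    have hv : ∀ {a : ℝ}, 0 ≤ a → ∫ t in (0 : ℝ)..1, t ^ a = 1 / (a + 1) := fun {a} ha => by
      rw [integral_rpow (Or.inl (by linarith)), Real.one_rpow,
        Real.zero_rpow (by linarith), sub_zero]
    have hd : ∀ {a : ℝ}, 0 ≤ a →
        IntervalIntegrable (fun t : ℝ => t ^ (y + a) - t ^ a) volume 0 1 ∧
        ∫ t in (0 : ℝ)..1, (t ^ (y + a) - t ^ a) = 1 / (y + a + 1) - 1 / (a + 1) := fun {a} ha =>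
      ⟨(hr (by linarith)).sub (hr ha), by
        rw [intervalIntegral.integral_sub (hr (by linarith)) (hr ha), hv (by linarith), hv ha]⟩
    obtain ⟨i1, v1⟩ := hd (a := 1) (by norm_num)
    obtain ⟨i2, v2⟩ := hd (a := 2) (by norm_num)
    obtain ⟨i3, v3⟩ := hd (a := 3) (by norm_num)
    have hsum : ∫ t in (0 : ℝ)..1, ((t ^ (y + 1) - t ^ (1 : ℝ))
        - 3 / 2 * (t ^ (y + 2) - t ^ (2 : ℝ)) + 3 / 4 * (t ^ (y + 3) - t ^ (3 : ℝ)))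
        = (1 / (y + 1 + 1) - 1 / (1 + 1)) - 3 / 2 * (1 / (y + 2 + 1) - 1 / (2 + 1))
          + 3 / 4 * (1 / (y + 3 + 1) - 1 / (3 + 1)) := by
      rw [intervalIntegral.integral_add (i1.sub (i2.const_mul _)) (i3.const_mul _),
        intervalIntegral.integral_sub i1 (i2.const_mul _),
        intervalIntegral.integral_const_mul, intervalIntegral.integral_const_mul, v1, v2, v3]
    have hint := (i1.sub (i2.const_mul (3 / 2))).add (i3.const_mul (3 / 4))
    rw [intervalIntegrable_iff_integrableOn_Ioc_of_le zero_le_one] at hint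
    rw [intervalIntegral.integral_of_le zero_le_one] at hsum
    calc -y * (25 / 192) ≤ (1 / (y + 1 + 1) - 1 / (1 + 1))
          - 3 / 2 * (1 / (y + 2 + 1) - 1 / (2 + 1))
          + 3 / 4 * (1 / (y + 3 + 1) - 1 / (3 + 1)) := by
          rw [← sub_nonneg]
          have : (1 / (y + 1 + 1) - 1 / (1 + 1)) - 3 / 2 * (1 / (y + 2 + 1) - 1 / (2 + 1))
              + 3 / 4 * (1 / (y + 3 + 1) - 1 / (3 + 1)) - -y * (25 / 192)
              = y ^ 2 * (25 * y ^ 2 + 189 * y + 374) / (192 * (y + 2) * (y + 3) * (y + 4)) := by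
            field_simp
            ring
          rw [this]
          positivity
      _ ≤ _ := by
        rw [← hsum]
        refine setIntegral_mono_on hint (hI.mono_set Set.Ioc_subset_Ioi_self)
          measurableSet_Ioc fun t ht => ?_
        have hq := exp_neg_div_add_one_le ht.1.le
        have hle : t ^ y ≤ 1 := Real.rpow_le_one ht.1.le ht.2 hy.le
        have e : ∀ n : ℕ, t ^ (y + n) = t ^ y * t ^ n := fun n => Real.rpow_add_natCast ht.1.ne' y n
        have e1 := e 1
        have e2 := e 2
        have e3 := e 3
        push_cast at e1 e2 e3
        have f2 : t ^ (2 : ℝ) = t ^ 2 := by norm_cast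
        have f3 : t ^ (3 : ℝ) = t ^ 3 := by norm_cast
        rw [e1, e2, e3, f2, f3, zero_add, Real.rpow_one]
        have := mul_le_mul_of_nonneg_right hq
          (mul_nonneg (sub_nonneg.2 hle) ht.1.le)
        have e4 : Real.exp (-t) * (t ^ y * t ^ 1) / (t + 1) - Real.exp (-t) * t / (t + 1)
            = -(Real.exp (-t) / (t + 1) * ((1 - t ^ y) * t)) := by ring
        rw [e4]
        linarith
  have hexp : 25 / 72 < Real.exp (-1) := by
    rw [Real.exp_neg, lt_inv_comm₀ (by norm_num) (Real.exp_pos 1)]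
    exact Real.exp_one_lt_d9.trans (by norm_num)
  nlinarith [mul_pos hy (sub_pos.2 hexp)]

lemma reAltKurepa_pos {y : ℝ} (hy : 0 < y) : 0 < reAltKurepa y := by
  rw [reAltKurepa_eq (by linarith)]
  have h1 := kurepaMellin_zero_lt hy
  have h2 := mul_le_mul_of_nonneg_right (Real.cos_le_one (Real.pi * y)) kurepaMellin_zero_nonneg
  linarith

/-- Let `x₁ ∈ (−2, 0)` be the unique zero of `F` in `(−2, 0)`.  Then for every `k ≥ 1` and
every `x ∈ (k, k+2+x₁] ∪ [k+2, ∞)` one has `F(x−k−1)/Γ(x−k) ≤ 1`, with equality iff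
`x = k+2+x₁` or `x = k+2`. -/
theorem reAltKurepa_div_gamma_le_one (x₁ : ℝ) (hx₁ : x₁ ∈ Set.Ioo (-2 : ℝ) 0)
    (hzero : reAltKurepa x₁ = 0)
    (huniq : ∀ y ∈ Set.Ioo (-2 : ℝ) 0, reAltKurepa y = 0 → y = x₁)
    (k : ℕ) (hk : 1 ≤ k) (x : ℝ)
    (hx : x ∈ Set.Ioc (k : ℝ) ((k : ℝ) + 2 + x₁) ∪ Set.Ici ((k : ℝ) + 2)) :
    reAltKurepa (x - k - 1) / Real.Gamma (x - k) ≤ 1 ∧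
      (reAltKurepa (x - k - 1) / Real.Gamma (x - k) = 1 ↔
        x = (k : ℝ) + 2 + x₁ ∨ x = (k : ℝ) + 2) := by
  have hy : -1 < x - k - 1 := by
    rcases hx with h | h
    · linarith [h.1]
    · linarith [Set.mem_Ici.1 h]
  have hΓ : 0 < Real.Gamma (x - k) := Real.Gamma_pos_of_pos (by linarith)
  have hrec := reAltKurepa_add_sub_one hy
  rw [sub_add_cancel] at hrec
  have key : 0 ≤ reAltKurepa (x - k - 1 - 1) ∧ (reAltKurepa (x - k - 1 - 1) = 0 ↔
      x = (k : ℝ) + 2 + x₁ ∨ x = (k : ℝ) + 2) := by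
    rcases hx with h | h
    · rcases h.2.eq_or_lt with h' | h'
      · rw [show x - k - 1 - 1 = x₁ by linarith, hzero]
        simp [h']
      · have hpos : 0 < reAltKurepa (x - k - 1 - 1) :=
          reAltKurepa_pos_of_forall_ne_zero (by linarith) fun y h1 h2 h0 => by
            have := huniq y ⟨h1, by linarith [hx₁.2]⟩ h0
            linarith
        refine ⟨hpos.le, iff_of_false hpos.ne' ?_⟩
        rintro (h1 | h1) <;> linarith [hx₁.2]
    · rcases (Set.mem_Ici.1 h).eq_or_lt with h' | h'
      · rw [show x - k - 1 - 1 = 0 by linarith, reAltKurepa_zero]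
        simp [← h']
      · have hpos : 0 < reAltKurepa (x - k - 1 - 1) := reAltKurepa_pos (by linarith)
        refine ⟨hpos.le, iff_of_false hpos.ne' ?_⟩
        rintro (h1 | h1) <;> linarith [hx₁.2]
  refine ⟨(div_le_one hΓ).2 (by linarith [key.1]), ?_⟩
  rw [← key.2, div_eq_one_iff_eq hΓ.ne']
  constructor <;> intro h <;> linarith
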